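/- Let n ≥ 1 and let w ∈ H²_loc(ℝ^n) satisfy Δw ≡ C almost everywhere for some constant C with |C| ≥ 1. Then w is a global minimizer of F. -/

import Mathlib

open MeasureTheory Metric Set Filter Topology
open scoped ENNReal

noncomputable section

/-- `n`-dimensional Euclidean space. -/
abbrev RH (n : ℕ) := EuclideanSpace ℝ (Fin n)

variable {n : ℕ}

/-- Smooth compactly supported test functions with support contained in `Ω`. -/
def IsTestFun (Ω : Set (RH n)) (φ : RH n → ℝ) : Prop :=
  ContDiff ℝ (⊤ : ℕ∞) φ ∧ HasCompactSupport φ ∧ tsupport φ ⊆ Ω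

/-- Classical partial derivative in the `i`-th coordinate direction. -/
def cpderiv (i : Fin n) (φ : RH n → ℝ) : RH n → ℝ :=
  fun x => fderiv ℝ φ x (EuclideanSpace.single i 1)

/-- Classical Laplacian of a (smooth) function. -/
def cLaplacian (φ : RH n → ℝ) : RH n → ℝ :=
  fun x => ∑ i, cpderiv i (cpderiv i φ) x

/-- `g` is the weak `i`-th partial derivative of `u` on `Ω`. -/
def IsWeakPartial (Ω : Set (RH n)) (i : Fin n) (u g : RH n → ℝ) : Prop :=
  ∀ φ : RH n → ℝ, IsTestFun Ω φ →
    ∫ x in Ω, u x * cpderiv i φ x = - ∫ x in Ω, g x * φ x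

/-- `g` is a weak Laplacian of `u` on `Ω`. -/
def IsWeakLaplacian (Ω : Set (RH n)) (u g : RH n → ℝ) : Prop :=
  ∀ φ : RH n → ℝ, IsTestFun Ω φ →
    ∫ x in Ω, u x * cLaplacian φ x = ∫ x in Ω, g x * φ x

/-- `u ∈ H²(Ω)` with weak gradient `g` and weak Hessian `h`. -/
def IsH2With (Ω : Set (RH n)) (u : RH n → ℝ) (g : Fin n → RH n → ℝ)
    (h : Fin n → Fin n → RH n → ℝ) : Prop :=
  MemLp u 2 (volume.restrict Ω) ∧
  (∀ i, IsWeakPartial Ω i u (g i) ∧ MemLp (g i) 2 (volume.restrict Ω)) ∧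
  (∀ i j, IsWeakPartial Ω j (g i) (h i j) ∧ MemLp (h i j) 2 (volume.restrict Ω))

/-- `u ∈ H²(Ω)`. -/
def MemH2 (Ω : Set (RH n)) (u : RH n → ℝ) : Prop :=
  ∃ g h, IsH2With Ω u g h

/-- `u ∈ H₀²(Ω)`: `u ∈ H²(Ω)` and `u` is approximable in the `H²`-norm by
test functions supported in `Ω`. -/
def MemH20 (Ω : Set (RH n)) (u : RH n → ℝ) : Prop :=
  ∃ g h, IsH2With Ω u g h ∧
    ∃ φ : ℕ → RH n → ℝ, (∀ k, IsTestFun Ω (φ k)) ∧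
      Tendsto (fun k => eLpNorm (fun x => u x - φ k x) 2 (volume.restrict Ω)) atTop (𝓝 0) ∧
      (∀ i, Tendsto (fun k => eLpNorm (fun x => g i x - cpderiv i (φ k) x) 2
        (volume.restrict Ω)) atTop (𝓝 0)) ∧
      (∀ i j, Tendsto (fun k => eLpNorm (fun x => h i j x - cpderiv j (cpderiv i (φ k)) x) 2
        (volume.restrict Ω)) atTop (𝓝 0))

/-- `u ∈ H²_loc(ℝⁿ)`. -/
def MemH2loc (u : RH n → ℝ) : Prop :=
  ∀ Ω : Set (RH n), IsOpen Ω → Bornology.IsBounded Ω → MemH2 Ω u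

/-- The two-sided biharmonic Alt–Caffarelli functional
`F(u,Ω) = ∫_Ω (Δu)² dx + |{x ∈ Ω : u x ≠ 0}|`, where the (weak) Laplacian
`Δu = lapu` is given explicitly. -/
def ACF (Ω : Set (RH n)) (lapu u : RH n → ℝ) : ℝ :=
  (∫ x in Ω, (lapu x) ^ 2) + (volume {x ∈ Ω | u x ≠ 0}).toReal

/-- `u` is a global minimizer of the two-sided biharmonic Alt–Caffarelli functional. -/
def IsGlobalMinimizer (u : RH n → ℝ) : Prop :=
  MemH2loc u ∧
  ∀ Ω : Set (RH n), IsOpen Ω → Bornology.IsBounded Ω →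
    ∀ v : RH n → ℝ, MemH2 Ω v → MemH20 Ω (fun x => v x - u x) →
      ∀ lapu lapv : RH n → ℝ, IsWeakLaplacian Ω u lapu → IsWeakLaplacian Ω v lapv →
        ACF Ω lapu u ≤ ACF Ω lapv v


open scoped Convolution

/-- The bump of outer radius `2 / (k + 1)` and inner radius `1 / (k + 1)`. -/
def shrinkingBump (n k : ℕ) : ContDiffBump (0 : RH n) where
  rIn := 1 / (k + 1)
  rOut := 2 / (k + 1)
  rIn_pos := by positivity
  rIn_lt_rOut := by gcongr; norm_num

/-- A sequence of standard mollifiers on `ℝⁿ`. -/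
def mollifier (n k : ℕ) : RH n → ℝ := (shrinkingBump n k).normed volume

/-- The convolution of `U` with the `k`-th standard mollifier. -/
def mollify (k : ℕ) (U : RH n → ℝ) : RH n → ℝ :=
  U ⋆[ContinuousLinearMap.mul ℝ ℝ, volume] mollifier n k

lemma mollify_apply (k : ℕ) (U : RH n → ℝ) (x : RH n) :
    mollify k U x = ∫ t, U t * mollifier n k (x - t) := rfl

lemma tendsto_rOut_shrinkingBump :
    Tendsto (fun k => (shrinkingBump n k).rOut) atTop (𝓝 0) := by
  have h := (tendsto_one_div_add_atTop_nhds_zero_nat (𝕜 := ℝ)).const_mul 2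
  simp only [mul_zero] at h
  refine h.congr fun k => ?_
  simp only [shrinkingBump]
  ring

lemma contDiff_mollifier (k : ℕ) : ContDiff ℝ (⊤ : ℕ∞) (mollifier n k) :=
  (shrinkingBump n k).contDiff_normed

lemma hasCompactSupport_mollifier (k : ℕ) : HasCompactSupport (mollifier n k) :=
  (shrinkingBump n k).hasCompactSupport_normed

lemma mollifier_nonneg (k : ℕ) (x : RH n) : 0 ≤ mollifier n k x :=
  (shrinkingBump n k).nonneg_normed x

lemma integral_mollifier (k : ℕ) : ∫ x, mollifier n k x = 1 :=
  (shrinkingBump n k).integral_normed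

lemma integrable_mollifier (k : ℕ) : Integrable (mollifier n k) :=
  (contDiff_mollifier k).continuous.integrable_of_hasCompactSupport
    (hasCompactSupport_mollifier k)

lemma contDiff_mollify (k : ℕ) {U : RH n → ℝ} (hU : Integrable U) :
    ContDiff ℝ (⊤ : ℕ∞) (mollify k U) :=
  (hasCompactSupport_mollifier k).contDiff_convolution_right _ hU.locallyIntegrable
    (contDiff_mollifier k)

lemma integrable_mollify (k : ℕ) {U : RH n → ℝ} (hU : Integrable U) :
    Integrable (mollify k U) :=
  hU.integrable_convolution _ (integrable_mollifier k)

lemma integral_mollify (k : ℕ) {U : RH n → ℝ} (hU : Integrable U) :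
    ∫ x, mollify k U x = ∫ x, U x := by
  have h : ∫ x, mollify k U x = _ :=
    integral_convolution (ContinuousLinearMap.mul ℝ ℝ) hU (integrable_mollifier k)
  rw [h, integral_mollifier, ContinuousLinearMap.mul_apply', mul_one]

lemma abs_mollify_le (k : ℕ) (U : RH n → ℝ) (x : RH n) :
    |mollify k U x| ≤ mollify k (fun y => |U y|) x := by
  rw [mollify_apply, mollify_apply]
  refine (norm_integral_le_integral_norm (fun t => U t * mollifier n k (x - t))).trans_eq ?_
  simp [abs_of_nonneg (mollifier_nonneg k _)]

lemma ae_tendsto_mollify {U : RH n → ℝ} (hU : Integrable U) :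
    ∀ᵐ x, Tendsto (fun k => mollify k U x) atTop (𝓝 (U x)) := by
  have h := ContDiffBump.ae_convolution_tendsto_right_of_locallyIntegrable
    (φ := fun k => shrinkingBump n k) (g := U) (K := 2) (μ := volume) tendsto_rOut_shrinkingBump
    (Eventually.of_forall fun k => by simp only [shrinkingBump]; apply le_of_eq; ring)
    hU.locallyIntegrable
  filter_upwards [h] with x hx
  refine hx.congr fun k => ?_
  rw [convolution_eq_swap, mollify_apply]
  simp [mollifier, mul_comm]

/-- Mollifications of an integrable function converge in `L¹`. -/
lemma tendsto_integral_abs_mollify_sub {U : RH n → ℝ} (hU : Integrable U) :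
    Tendsto (fun k => ∫ x, |mollify k U x - U x|) atTop (𝓝 0) := by
  have hA := hU.abs
  have hint : ∀ k, Integrable (fun x => |mollify k U x - U x|) := fun k =>
    ((integrable_mollify k hU).sub hU).abs
  have hintA : ∀ k, Integrable (fun x => mollify k (fun y => |U y|) x - |U x|) := fun k =>
    (integrable_mollify k hA).sub hA
  have hB : Tendsto (fun k => ∫ x, max (|mollify k U x - U x| -
      (mollify k (fun y => |U y|) x - |U x|)) 0) atTop (𝓝 (∫ _ : RH n, (0 : ℝ))) := by
    refine tendsto_integral_of_dominated_convergence (fun x => 2 * |U x|)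
      (fun k => (((hint k).sub (hintA k)).pos_part).aestronglyMeasurable)
      (hA.const_mul 2) (fun k => Eventually.of_forall fun x => ?_) ?_
    · rw [Real.norm_eq_abs, abs_of_nonneg (le_max_right _ _)]
      refine max_le ?_ (by positivity)
      have h1 := abs_sub (mollify k U x) (U x)
      have h2 := abs_mollify_le k U x
      linarith
    · filter_upwards [ae_tendsto_mollify hU, ae_tendsto_mollify hA] with x h1 h2
      have h3 := (((h1.sub_const (U x)).abs).sub (h2.sub_const |U x|)).max
        (tendsto_const_nhds (x := (0 : ℝ)))
      simpa using h3
  rw [integral_zero] at hB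
  refine squeeze_zero (fun k => integral_nonneg fun x => abs_nonneg _) (fun k => ?_) hB
  have h0 : ∫ x, (mollify k (fun y => |U y|) x - |U x|) = 0 := by
    rw [integral_sub (integrable_mollify k hA) hA, integral_mollify k hA, sub_self]
  have h1 : ∫ x, |mollify k U x - U x| = ∫ x, (|mollify k U x - U x| -
      (mollify k (fun y => |U y|) x - |U x|)) := by
    rw [integral_sub (hint k) (hintA k), h0, sub_zero]
  rw [h1]
  exact integral_mono ((hint k).sub (hintA k)) (((hint k).sub (hintA k)).pos_part)
    fun x => le_max_left _ _

/-- If `G k → G` in `L¹` and the `Ψ k` are uniformly bounded and converge a.e. to `Ψ`, then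
`∫ Ψ k * G k → ∫ Ψ * G`. -/
lemma tendsto_integral_mul_of_bounded {α : Type*} [MeasurableSpace α] {μ : Measure α}
    {G Ψ : α → ℝ} {Gk Ψk : ℕ → α → ℝ} {M : ℝ} (hG : Integrable G μ)
    (hGk : ∀ k, Integrable (Gk k) μ)
    (hL1 : Tendsto (fun k => ∫ x, |Gk k x - G x| ∂μ) atTop (𝓝 0))
    (hmeas : ∀ k, AEStronglyMeasurable (Ψk k) μ) (hbd : ∀ k x, |Ψk k x| ≤ M)
    (hlim : ∀ᵐ x ∂μ, Tendsto (fun k => Ψk k x) atTop (𝓝 (Ψ x))) :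
    Tendsto (fun k => ∫ x, Ψk k x * Gk k x ∂μ) atTop (𝓝 (∫ x, Ψ x * G x ∂μ)) := by
  have hbd' : ∀ k, ∀ᵐ x ∂μ, ‖Ψk k x‖ ≤ M := fun k => Eventually.of_forall (hbd k)
  have hmain : Tendsto (fun k => ∫ x, Ψk k x * G x ∂μ) atTop (𝓝 (∫ x, Ψ x * G x ∂μ)) := by
    refine tendsto_integral_of_dominated_convergence (fun x => M * |G x|)
      (fun k => (hG.bdd_mul (hmeas k) (hbd' k)).aestronglyMeasurable) (hG.abs.const_mul M)
      (fun k => Eventually.of_forall fun x => ?_) ?_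
    · rw [norm_mul]
      exact mul_le_mul_of_nonneg_right (hbd k x) (abs_nonneg _)
    · filter_upwards [hlim] with x hx using hx.mul_const _
  have herr : Tendsto (fun k => ∫ x, Ψk k x * (Gk k x - G x) ∂μ) atTop (𝓝 0) := by
    refine squeeze_zero_norm (fun k => ?_) (by simpa using hL1.const_mul M)
    refine (norm_integral_le_integral_norm _).trans ?_
    rw [← integral_const_mul]
    refine integral_mono (((hGk k).sub hG).bdd_mul (hmeas k) (hbd' k)).norm
      (((hGk k).sub hG).abs.const_mul M) fun x => ?_
    simp only [norm_mul]
    exact mul_le_mul_of_nonneg_right (hbd k x) (abs_nonneg _)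
  have hsum := hmain.add herr
  rw [add_zero] at hsum
  refine hsum.congr fun k => ?_
  have hi : Integrable (fun x => Ψk k x * (Gk k x - G x)) μ :=
    ((hGk k).sub hG).bdd_mul (hmeas k) (hbd' k)
  rw [← integral_add (hG.bdd_mul (hmeas k) (hbd' k)) hi]
  exact integral_congr_ae (Eventually.of_forall fun x => by simp only; ring)

lemma IsTestFun.continuous {Ω : Set (RH n)} {φ : RH n → ℝ} (hφ : IsTestFun Ω φ) :
    Continuous φ := hφ.1.continuous

lemma IsTestFun.exists_bound {Ω : Set (RH n)} {φ : RH n → ℝ} (hφ : IsTestFun Ω φ) :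
    ∃ M, ∀ x, |φ x| ≤ M :=
  hφ.continuous.bounded_above_of_compact_support hφ.2.1

lemma IsTestFun.integrable {Ω : Set (RH n)} {φ : RH n → ℝ} (hφ : IsTestFun Ω φ) :
    Integrable φ := hφ.continuous.integrable_of_hasCompactSupport hφ.2.1

lemma IsTestFun.cpderiv {Ω : Set (RH n)} {φ : RH n → ℝ} (hφ : IsTestFun Ω φ) (i : Fin n) :
    IsTestFun Ω (cpderiv i φ) :=
  ⟨(hφ.1.fderiv_right (m := (⊤ : ℕ∞)) le_rfl).clm_apply contDiff_const,
    hφ.2.1.fderiv_apply ℝ _, (tsupport_fderiv_apply_subset ℝ _).trans hφ.2.2⟩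

lemma IsTestFun.add {Ω : Set (RH n)} {φ ψ : RH n → ℝ} (hφ : IsTestFun Ω φ)
    (hψ : IsTestFun Ω ψ) : IsTestFun Ω (fun x => φ x + ψ x) :=
  ⟨hφ.1.add hψ.1, hφ.2.1.add hψ.2.1,
    (tsupport_add φ ψ).trans (union_subset hφ.2.2 hψ.2.2)⟩

lemma IsTestFun.integrable_mul {Ω : Set (RH n)} {φ f : RH n → ℝ} (hφ : IsTestFun Ω φ)
    (hf : IntegrableOn f Ω) : IntegrableOn (fun x => f x * φ x) Ω := by
  obtain ⟨M, hM⟩ := hφ.exists_bound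
  exact hf.mul_bdd (c := M) hφ.continuous.aestronglyMeasurable (Eventually.of_forall hM)

/-- Mollification turns a weak partial derivative into a classical one, away from the boundary. -/
lemma fderiv_mollify {Ω : Set (RH n)} (hΩ : MeasurableSet Ω) {i : Fin n} {u g : RH n → ℝ}
    (hu : IntegrableOn u Ω) (hug : IsWeakPartial Ω i u g) {k : ℕ} {x : RH n}
    (hx : closedBall x (shrinkingBump n k).rOut ⊆ Ω) :
    fderiv ℝ (mollify k (Ω.indicator u)) x (EuclideanSpace.single i 1) =
      mollify k (Ω.indicator g) x := by
  have hU : Integrable (Ω.indicator u) := hu.integrable_indicator hΩ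
  set ψ : RH n → ℝ := fun t => mollifier n k (x - t) with hψ
  have hsupp : Function.support ψ ⊆ closedBall x (shrinkingBump n k).rOut := by
    intro t ht
    have h1 : x - t ∈ Function.support (mollifier n k) := ht
    rw [mollifier, ContDiffBump.support_normed_eq, mem_ball_zero_iff] at h1
    rw [mem_closedBall, dist_comm, dist_eq_norm]
    exact h1.le
  have htest : IsTestFun Ω ψ := by
    refine ⟨(contDiff_mollifier k).comp (contDiff_const.sub contDiff_id),
      HasCompactSupport.intro (isCompact_closedBall x (shrinkingBump n k).rOut)
        fun t ht => Function.notMem_support.1 fun h => ht (hsupp h),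
      (closure_minimal hsupp isClosed_closedBall).trans hx⟩
  have hder : ∀ t, cpderiv i ψ t =
      - fderiv ℝ (mollifier n k) (x - t) (EuclideanSpace.single i 1) := by
    intro t
    have h1 : HasFDerivAt (mollifier n k) (fderiv ℝ (mollifier n k) (x - t)) (x - t) :=
      ((contDiff_mollifier k).differentiable (by simp) _).hasFDerivAt
    have h2 := h1.comp t ((hasFDerivAt_id t).const_sub x)
    have h3 : fderiv ℝ ψ t = _ := h2.fderiv
    simp [cpderiv, h3]
  have hd := (hasCompactSupport_mollifier k).hasFDerivAt_convolution_right
    (ContinuousLinearMap.mul ℝ ℝ) hU.locallyIntegrable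
    ((contDiff_mollifier k).of_le (by simp)) x
  rw [show fderiv ℝ (mollify k (Ω.indicator u)) x = _ from hd.fderiv,
    convolution_precompR_apply _ hU.locallyIntegrable
      ((hasCompactSupport_mollifier k).fderiv ℝ)
      ((contDiff_mollifier k).continuous_fderiv (by simp))]
  have hw := hug ψ htest
  have hind : ∀ f q : RH n → ℝ, ∫ t, Ω.indicator f t * q t = ∫ t in Ω, f t * q t := by
    intro f q
    rw [← integral_indicator hΩ]
    congr 1 with t
    by_cases ht : t ∈ Ω <;> simp [ht]
  rw [mollify_apply, hind g ψ, ← neg_eq_iff_eq_neg.2 hw, ← hind u, ← integral_neg]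
  simp only [convolution_def, hder, mul_neg, neg_neg, ContinuousLinearMap.mul_apply']

lemma abs_arctan_le (t : ℝ) : |Real.arctan t| ≤ Real.pi / 2 :=
  abs_le.2 ⟨by linarith [Real.neg_pi_div_two_lt_arctan t], (Real.arctan_lt_pi_div_two t).le⟩

lemma abs_one_div_one_add_sq_le (t : ℝ) : |1 / (1 + t ^ 2)| ≤ 1 := by
  rw [abs_of_nonneg (by positivity), div_le_one (by positivity)]
  nlinarith [sq_nonneg t]

/-- The chain rule for `arctan (m * u)`, tested against `φ`. -/
lemma integral_arctan_mul_cpderiv {Ω : Set (RH n)} (hΩ : IsOpen Ω) {i : Fin n}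
    {u g : RH n → ℝ} (hu : IntegrableOn u Ω) (hg : IntegrableOn g Ω)
    (hug : IsWeakPartial Ω i u g) (m : ℝ) {φ : RH n → ℝ} (hφ : IsTestFun Ω φ) :
    ∫ x, Real.arctan (m * Ω.indicator u x) * cpderiv i φ x =
      - (m * ∫ x, (1 / (1 + (m * Ω.indicator u x) ^ 2) * φ x) * Ω.indicator g x) := by
  have hU : Integrable (Ω.indicator u) := hu.integrable_indicator hΩ.measurableSet
  have hG : Integrable (Ω.indicator g) := hg.integrable_indicator hΩ.measurableSet
  set U := Ω.indicator u
  set G := Ω.indicator g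
  set e : RH n := EuclideanSpace.single i 1
  obtain ⟨M, hM⟩ := hφ.exists_bound
  have hUk : ∀ k, ContDiff ℝ (⊤ : ℕ∞) (mollify k U) := fun k => contDiff_mollify k hU
  have hcont : ∀ k, Continuous (fun x => 1 / (1 + (m * mollify k U x) ^ 2) * φ x) := fun k =>
    (continuous_const.div (by have := (hUk k).continuous; fun_prop)
      fun x => by positivity).mul hφ.continuous
  have hlhs : Tendsto (fun k => ∫ x, Real.arctan (m * mollify k U x) * cpderiv i φ x) atTop
      (𝓝 (∫ x, Real.arctan (m * U x) * cpderiv i φ x)) := by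
    refine tendsto_integral_of_dominated_convergence
      (fun x => Real.pi / 2 * |cpderiv i φ x|) (fun k => ?_)
      ((hφ.cpderiv i).integrable.abs.const_mul _)
      (fun k => Eventually.of_forall fun x => ?_) ?_
    · exact ((Real.continuous_arctan.comp (continuous_const.mul (hUk k).continuous)).mul
        (hφ.cpderiv i).continuous).aestronglyMeasurable
    · rw [norm_mul]
      exact mul_le_mul_of_nonneg_right (abs_arctan_le _) (abs_nonneg _)
    · filter_upwards [ae_tendsto_mollify hU] with x hx
      exact ((Real.continuous_arctan.tendsto _).comp (hx.const_mul m)).mul_const _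
  have hrhs : Tendsto (fun k => ∫ x, (1 / (1 + (m * mollify k U x) ^ 2) * φ x) * mollify k G x)
      atTop (𝓝 (∫ x, (1 / (1 + (m * U x) ^ 2) * φ x) * G x)) := by
    refine tendsto_integral_mul_of_bounded (M := M) hG (fun k => integrable_mollify k hG)
      (tendsto_integral_abs_mollify_sub hG) (fun k => (hcont k).aestronglyMeasurable)
      (fun k x => ?_) ?_
    · rw [abs_mul]
      exact (mul_le_of_le_one_left (abs_nonneg _) (abs_one_div_one_add_sq_le _)).trans (hM x)
    · filter_upwards [ae_tendsto_mollify hU] with x hx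
      exact (tendsto_const_nhds.div (tendsto_const_nhds.add ((hx.const_mul m).pow 2))
        (by positivity)).mul_const _
  obtain ⟨δ, hδ, hδΩ⟩ := hφ.2.1.isCompact.exists_cthickening_subset_open hΩ hφ.2.2
  refine tendsto_nhds_unique (hlhs.congr' ?_) (hrhs.const_mul m).neg
  filter_upwards [tendsto_rOut_shrinkingBump.eventually (gt_mem_nhds hδ)] with k hk
  have hdiff : Differentiable ℝ (mollify k U) := (hUk k).differentiable (by simp)
  have hF : ∀ x, HasFDerivAt (fun y => Real.arctan (m * mollify k U y))
      ((1 / (1 + (m * mollify k U x) ^ 2)) • m • fderiv ℝ (mollify k U) x) x := fun x =>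
    ((hdiff x).hasFDerivAt.const_mul m).arctan
  have hFd : ∀ x, fderiv ℝ (fun y => Real.arctan (m * mollify k U y)) x e * φ x =
      m * ((1 / (1 + (m * mollify k U x) ^ 2) * φ x) * mollify k G x) := by
    intro x
    by_cases hx : x ∈ tsupport φ
    · have hball : closedBall x (shrinkingBump n k).rOut ⊆ Ω :=
        (closedBall_subset_closedBall hk.le).trans
          ((closedBall_subset_cthickening hx δ).trans hδΩ)
      rw [(hF x).fderiv, ← fderiv_mollify hΩ.measurableSet hu hug hball]
      simp only [smul_apply, smul_eq_mul]
      ring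
    · simp [image_eq_zero_of_notMem_tsupport hx]
  have hFc : ContDiff ℝ (⊤ : ℕ∞) (fun y => Real.arctan (m * mollify k U y)) :=
    (contDiff_const.mul (hUk k)).arctan
  rw [← integral_const_mul]
  simp only [← hFd]
  have hFc' : Continuous fun x => fderiv ℝ (fun y => Real.arctan (m * mollify k U y)) x e :=
    (hFc.continuous_fderiv (by simp)).clm_apply continuous_const
  exact integral_mul_fderiv_eq_neg_fderiv_mul_of_integrable
    ((hFc'.mul hφ.continuous).integrable_of_hasCompactSupport hφ.2.1.mul_left)
    ((hFc.continuous.mul (hφ.cpderiv i).continuous).integrable_of_hasCompactSupport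
      (hφ.cpderiv i).2.1.mul_left)
    ((hFc.continuous.mul hφ.continuous).integrable_of_hasCompactSupport hφ.2.1.mul_left)
    (fun x _ => (hF x).differentiableAt) (fun x _ => hφ.1.differentiable (by simp) x)

/-- A weak partial derivative of `u` vanishes almost everywhere on `{u = 0}`. -/
lemma IsWeakPartial.ae_eq_zero {Ω : Set (RH n)} (hΩ : IsOpen Ω) {i : Fin n}
    {u g : RH n → ℝ} (hu : IntegrableOn u Ω) (hg : IntegrableOn g Ω)
    (hug : IsWeakPartial Ω i u g) : ∀ᵐ x, x ∈ Ω → u x = 0 → g x = 0 := by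
  have hU : Integrable (Ω.indicator u) := hu.integrable_indicator hΩ.measurableSet
  have hG : Integrable (Ω.indicator g) := hg.integrable_indicator hΩ.measurableSet
  have hZ : NullMeasurableSet {x | Ω.indicator u x = 0} :=
    hU.aemeasurable.nullMeasurableSet_preimage (measurableSet_singleton 0)
  have hint : Integrable ({x | Ω.indicator u x = 0}.indicator (Ω.indicator g)) :=
    hG.indicator₀ hZ
  have key := hΩ.ae_eq_zero_of_integral_contDiff_smul_eq_zero
    (hint.locallyIntegrable.locallyIntegrableOn Ω) fun φ h1 h2 h3 => by
    have hφ : IsTestFun Ω φ := ⟨h1, h2, h3⟩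
    obtain ⟨M, hM⟩ := hφ.exists_bound
    have hlim : Tendsto (fun m : ℕ => ∫ x, (1 / (1 + (((m : ℝ) + 1) * Ω.indicator u x) ^ 2) * φ x)
        * Ω.indicator g x) atTop
        (𝓝 (∫ x, φ x • {x | Ω.indicator u x = 0}.indicator (Ω.indicator g) x)) := by
      refine tendsto_integral_of_dominated_convergence (fun x => M * |Ω.indicator g x|)
        (fun m => ?_) (hG.abs.const_mul M) (fun m => Eventually.of_forall fun x => ?_)
        (Eventually.of_forall fun x => ?_)
      · have hUm := hU.aemeasurable
        have hφm := hφ.continuous.measurable.aemeasurable (μ := volume)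
        have hGm := hG.aemeasurable
        exact AEMeasurable.aestronglyMeasurable (by fun_prop)
      · rw [norm_mul, norm_mul]
        exact mul_le_mul_of_nonneg_right
          ((mul_le_of_le_one_left (abs_nonneg _) (abs_one_div_one_add_sq_le _)).trans (hM x)) (abs_nonneg _)
      · by_cases hx : Ω.indicator u x = 0
        · rw [indicator_of_mem (show x ∈ {x | Ω.indicator u x = 0} from hx)]
          simp [hx]
        · have hdiv : Tendsto (fun m : ℕ => 1 / (1 + (((m : ℝ) + 1) * Ω.indicator u x) ^ 2))
              atTop (𝓝 0) := by
            refine tendsto_const_nhds.div_atTop (tendsto_atTop_add_const_left _ _ ?_)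
            have hn : Tendsto (fun m : ℕ => (m : ℝ) + 1) atTop atTop :=
              tendsto_atTop_add_const_right _ _ tendsto_natCast_atTop_atTop
            have hsq : Tendsto (fun m : ℕ => ((m : ℝ) + 1) ^ 2) atTop atTop :=
              (tendsto_pow_atTop two_ne_zero).comp hn
            simp only [mul_pow]
            exact hsq.atTop_mul_const (by positivity)
          have h0 := (hdiv.mul_const (φ x)).mul_const (Ω.indicator g x)
          rw [indicator_of_notMem (show x ∉ {x | Ω.indicator u x = 0} from hx)]
          simpa using h0
    refine tendsto_nhds_unique hlim ?_
    refine squeeze_zero_norm (a := fun m : ℕ =>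
      (1 / ((m : ℝ) + 1)) * ∫ x, Real.pi / 2 * |cpderiv i φ x|) (fun m => ?_)
      (by simpa only [zero_mul] using (tendsto_one_div_add_atTop_nhds_zero_nat
        (𝕜 := ℝ)).mul_const (∫ x, Real.pi / 2 * |cpderiv i φ x|))
    have hm : (0 : ℝ) < (m : ℝ) + 1 := by positivity
    have hid := integral_arctan_mul_cpderiv hΩ hu hg hug ((m : ℝ) + 1) hφ
    have hbound : ‖∫ x, Real.arctan (((m : ℝ) + 1) * Ω.indicator u x) * cpderiv i φ x‖ ≤
        ∫ x, Real.pi / 2 * |cpderiv i φ x| := by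
      refine norm_integral_le_of_norm_le ((hφ.cpderiv i).integrable.abs.const_mul _)
        (Eventually.of_forall fun x => ?_)
      rw [norm_mul]
      exact mul_le_mul_of_nonneg_right (abs_arctan_le _) (abs_nonneg _)
    rw [hid, norm_neg, norm_mul, Real.norm_of_nonneg hm.le] at hbound
    rw [one_div_mul_eq_div, le_div_iff₀ hm, mul_comm]
    exact hbound
  filter_upwards [key] with x hx hxΩ hux
  have h := hx hxΩ
  rwa [indicator_of_mem (show x ∈ {x | Ω.indicator u x = 0} by simp [hxΩ, hux]),
    indicator_of_mem hxΩ] at h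

lemma LocallyIntegrableOn.of_integrableOn_mul_testFun {Ω : Set (RH n)} (hΩ : IsOpen Ω)
    {f : RH n → ℝ} (hf : ∀ φ, IsTestFun Ω φ → IntegrableOn (fun x => f x * φ x) Ω) :
    LocallyIntegrableOn f Ω := by
  intro x hx
  obtain ⟨r, hr, hrΩ⟩ := Metric.isOpen_iff.1 hΩ x hx
  let b : ContDiffBump x := ⟨r / 3, r / 2, by positivity, by linarith⟩
  have hb : IsTestFun Ω b := by
    refine ⟨b.contDiff, b.hasCompactSupport, ?_⟩
    rw [b.tsupport_eq]
    exact (closedBall_subset_ball (by change r / 2 < r; linarith)).trans hrΩ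
  have hsub : ball x (r / 3) ⊆ Ω := (ball_subset_ball (by linarith)).trans hrΩ
  refine ⟨ball x (r / 3), mem_nhdsWithin_of_mem_nhds (ball_mem_nhds x (by positivity)), ?_⟩
  refine ((hf b hb).mono_set hsub).congr_fun (fun y hy => ?_) measurableSet_ball
  simp [b.one_of_mem_closedBall (ball_subset_closedBall hy)]

lemma ae_eq_zero_of_setIntegral_mul_testFun_eq_zero {Ω : Set (RH n)} (hΩ : IsOpen Ω)
    {f : RH n → ℝ} (hf : LocallyIntegrableOn f Ω)
    (h : ∀ φ, IsTestFun Ω φ → ∫ x in Ω, f x * φ x = 0) : ∀ᵐ x, x ∈ Ω → f x = 0 := by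
  refine hΩ.ae_eq_zero_of_integral_contDiff_smul_eq_zero hf fun φ h1 h2 h3 => ?_
  rw [← h φ ⟨h1, h2, h3⟩, setIntegral_eq_integral_of_forall_compl_eq_zero fun x hx => by
    rw [image_eq_zero_of_notMem_tsupport fun h => hx (h3 h), mul_zero]]
  simp only [smul_eq_mul, mul_comm]

lemma IsWeakLaplacian.ae_eq {Ω : Set (RH n)} (hΩ : IsOpen Ω) {u f₁ f₂ : RH n → ℝ}
    (h₁ : IsWeakLaplacian Ω u f₁) (h₂ : IsWeakLaplacian Ω u f₂)
    (hf₁ : ∀ φ, IsTestFun Ω φ → IntegrableOn (fun x => f₁ x * φ x) Ω)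
    (hf₂ : IntegrableOn f₂ Ω) : ∀ᵐ x, x ∈ Ω → f₁ x = f₂ x := by
  have key := ae_eq_zero_of_setIntegral_mul_testFun_eq_zero hΩ
    (f := fun x => f₁ x - f₂ x)
    ((LocallyIntegrableOn.of_integrableOn_mul_testFun hΩ hf₁).sub hf₂.locallyIntegrableOn)
    fun φ hφ => by
      simp only [sub_mul]
      rw [integral_sub (hf₁ φ hφ) (hφ.integrable_mul hf₂), ← h₁ φ hφ, ← h₂ φ hφ, sub_self]
  filter_upwards [key] with x hx hxΩ using sub_eq_zero.1 (hx hxΩ)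

/-- A weak Laplacian `f` in the sense of `IsWeakLaplacian` agrees with the integrable weak
Laplacian `f₀` unless `f` is not locally integrable, in which case `f₀` vanishes. -/
lemma IsWeakLaplacian.ae_eq_or_ae_eq_zero {Ω : Set (RH n)} (hΩ : IsOpen Ω)
    {u f f₀ : RH n → ℝ} (h : IsWeakLaplacian Ω u f) (h₀ : IsWeakLaplacian Ω u f₀)
    (hf₀ : IntegrableOn f₀ Ω) :
    (∀ᵐ x, x ∈ Ω → f x = f₀ x) ∨ (∀ᵐ x, x ∈ Ω → f₀ x = 0) := by
  by_cases hf : ∀ φ, IsTestFun Ω φ → IntegrableOn (fun x => f x * φ x) Ω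
  · exact Or.inl (h.ae_eq hΩ h₀ hf hf₀)
  right
  push Not at hf
  obtain ⟨ψ, hψ, hfψ⟩ := hf
  have hzero : ∀ φ, IsTestFun Ω φ → ¬ IntegrableOn (fun x => f x * φ x) Ω →
      ∫ x in Ω, f₀ x * φ x = 0 := fun φ hφ hn => by
    rw [← h₀ φ hφ, h φ hφ, integral_undef hn]
  refine ae_eq_zero_of_setIntegral_mul_testFun_eq_zero hΩ hf₀.locallyIntegrableOn
    fun φ hφ => ?_
  by_cases hφf : IntegrableOn (fun x => f x * φ x) Ω
  · have hsum := hzero _ (hφ.add hψ) fun hc => hfψ <| by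
      refine (hc.sub hφf).congr (Eventually.of_forall fun x => ?_)
      simp only [Pi.sub_apply]
      ring
    simp only [mul_add] at hsum
    rwa [integral_add (hφ.integrable_mul hf₀) (hψ.integrable_mul hf₀), hzero ψ hψ hfψ,
      add_zero] at hsum
  · exact hzero φ hφ hφf

lemma IsH2With.isWeakLaplacian {Ω : Set (RH n)} [IsFiniteMeasure (volume.restrict Ω)]
    {u : RH n → ℝ} {g : Fin n → RH n → ℝ} {h : Fin n → Fin n → RH n → ℝ}
    (H : IsH2With Ω u g h) : IsWeakLaplacian Ω u (fun x => ∑ i, h i i x) := by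
  intro φ hφ
  have hu : IntegrableOn u Ω := H.1.integrable one_le_two
  simp only [cLaplacian, Finset.mul_sum, Finset.sum_mul]
  rw [integral_finsetSum _ fun i _ => ((hφ.cpderiv i).cpderiv i).integrable_mul hu,
    integral_finsetSum _ fun i _ =>
      hφ.integrable_mul ((H.2.2 i i).2.integrable one_le_two)]
  refine Finset.sum_congr rfl fun i _ => ?_
  rw [(H.2.1 i).1 _ (hφ.cpderiv i), (H.2.2 i i).1 φ hφ, neg_neg]

lemma IsH2With.memLp_laplacian {Ω : Set (RH n)} {u : RH n → ℝ} {g : Fin n → RH n → ℝ}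
    {h : Fin n → Fin n → RH n → ℝ} (H : IsH2With Ω u g h) :
    MemLp (fun x => ∑ i, h i i x) 2 (volume.restrict Ω) :=
  memLp_finsetSum _ fun i _ => (H.2.2 i i).2

/-- The Laplacian of an `H²` function `u` vanishes almost everywhere on `{u = 0}`. -/
lemma IsH2With.laplacian_ae_eq_zero {Ω : Set (RH n)} (hΩ : IsOpen Ω)
    [IsFiniteMeasure (volume.restrict Ω)] {u : RH n → ℝ} {g : Fin n → RH n → ℝ}
    {h : Fin n → Fin n → RH n → ℝ} (H : IsH2With Ω u g h) :
    ∀ᵐ x, x ∈ Ω → u x = 0 → ∑ i, h i i x = 0 := by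
  have hu : IntegrableOn u Ω := H.1.integrable one_le_two
  have hg : ∀ i, IntegrableOn (g i) Ω := fun i => (H.2.1 i).2.integrable one_le_two
  have h1 : ∀ᵐ x, ∀ i, x ∈ Ω → u x = 0 → g i x = 0 :=
    ae_all_iff.2 fun i => (H.2.1 i).1.ae_eq_zero hΩ hu (hg i)
  have h2 : ∀ᵐ x, ∀ i, x ∈ Ω → g i x = 0 → h i i x = 0 :=
    ae_all_iff.2 fun i => (H.2.2 i i).1.ae_eq_zero hΩ (hg i)
      ((H.2.2 i i).2.integrable one_le_two)
  filter_upwards [h1, h2] with x hx1 hx2 hxΩ hux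
  exact Finset.sum_eq_zero fun i _ => hx2 i hxΩ (hx1 i hxΩ hux)

lemma IsTestFun.setIntegral_cpderiv {Ω : Set (RH n)} {φ : RH n → ℝ} (hφ : IsTestFun Ω φ)
    (i : Fin n) : ∫ x in Ω, _root_.cpderiv i φ x = 0 := by
  rw [setIntegral_eq_integral_of_forall_compl_eq_zero fun x hx =>
    image_eq_zero_of_notMem_tsupport fun h => hx ((hφ.cpderiv i).2.2 h)]
  have h := integral_mul_fderiv_eq_neg_fderiv_mul_of_integrable (μ := volume)
    (f := fun _ : RH n => (1 : ℝ)) (g := φ) (v := EuclideanSpace.single i 1)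
    (by simp) (by simpa using! (hφ.cpderiv i).integrable) (by simpa using hφ.integrable)
    (fun x _ => differentiableAt_const _) (fun x _ => hφ.1.differentiable (by simp) x)
  simpa using! h

/-- The Laplacian of an `H²₀` function is a weak Laplacian with vanishing integral. -/
lemma MemH20.exists_laplacian {Ω : Set (RH n)} [IsFiniteMeasure (volume.restrict Ω)]
    {u : RH n → ℝ} (hu : MemH20 Ω u) :
    ∃ f, IntegrableOn f Ω ∧ IsWeakLaplacian Ω u f ∧ ∫ x in Ω, f x = 0 := by
  obtain ⟨g, h, H, φ, hφ, -, -, hlim⟩ := hu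
  refine ⟨_, H.memLp_laplacian.integrable one_le_two, H.isWeakLaplacian, ?_⟩
  have hint : ∀ i, IntegrableOn (h i i) Ω := fun i => (H.2.2 i i).2.integrable one_le_two
  rw [integral_finsetSum _ fun i _ => hint i]
  refine Finset.sum_eq_zero fun i _ => ?_
  have hφi : ∀ k, IsTestFun Ω (cpderiv i (cpderiv i (φ k))) := fun k =>
    ((hφ k).cpderiv i).cpderiv i
  have hL1 : Tendsto (fun k => eLpNorm (cpderiv i (cpderiv i (φ k)) - h i i) 1
      (volume.restrict Ω)) atTop (𝓝 0) := by
    have hc : (volume.restrict Ω) univ ^ (1 / (1 : ℝ≥0∞).toReal - 1 / (2 : ℝ≥0∞).toReal) ≠ ∞ :=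
      ENNReal.rpow_ne_top_of_nonneg (by norm_num) (measure_ne_top _ _)
    have hz := ENNReal.Tendsto.mul_const (hlim i i) (Or.inr hc)
    rw [zero_mul] at hz
    refine tendsto_of_tendsto_of_tendsto_of_le_of_le tendsto_const_nhds hz
      (fun k => zero_le) fun k => ?_
    rw [eLpNorm_sub_comm]
    exact eLpNorm_le_eLpNorm_mul_rpow_measure_univ one_le_two
      ((H.2.2 i i).2.1.sub (hφi k).continuous.aestronglyMeasurable)
  have ht := tendsto_integral_of_L1' (h i i) (hint i).aestronglyMeasurable
    (Eventually.of_forall fun k => (hφi k).integrable.integrableOn) hL1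
  simp only [((hφ _).cpderiv i).setIntegral_cpderiv i] at ht
  exact tendsto_nhds_unique ht tendsto_const_nhds

lemma integrable_indicator_ne_zero {α : Type*} [MeasurableSpace α] {μ : Measure α}
    [IsFiniteMeasure μ] {v : α → ℝ} (hv : AEMeasurable v μ) :
    Integrable ({x | v x ≠ 0}.indicator fun _ => (1 : ℝ)) μ ∧
      ∫ x, {x | v x ≠ 0}.indicator (fun _ => (1 : ℝ)) x ∂μ = (μ {x | v x ≠ 0}).toReal := by
  have hS : NullMeasurableSet {x | v x ≠ 0} μ :=
    hv.nullMeasurableSet_preimage (measurableSet_singleton 0).compl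
  refine ⟨(integrable_const 1).indicator₀ hS, ?_⟩
  rw [integral_indicator₀ hS]
  simp [Measure.real]

lemma ACF_congr_laplacian {Ω : Set (RH n)} (hΩ : IsOpen Ω) {f f₀ u : RH n → ℝ}
    (h : ∀ᵐ x, x ∈ Ω → f x = f₀ x) : ACF Ω f u = ACF Ω f₀ u := by
  rw [ACF, ACF, setIntegral_congr_ae hΩ.measurableSet (g := fun x => f₀ x ^ 2)]
  filter_upwards [h] with x hx hxΩ
  rw [hx hxΩ]

/-- If the Laplacian `f` of `v` vanishes where `v` does and has mean `C` with `|C| ≥ 1`, then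
`F(v, Ω) ≥ (C² + 1) |Ω|`. -/
lemma le_ACF_of_integral_eq {Ω : Set (RH n)} (hΩ : IsOpen Ω)
    [IsFiniteMeasure (volume.restrict Ω)] {f v : RH n → ℝ} {C : ℝ} (hC : 1 ≤ |C|)
    (hv : AEMeasurable v (volume.restrict Ω)) (hf : MemLp f 2 (volume.restrict Ω))
    (hfv : ∀ᵐ x, x ∈ Ω → v x = 0 → f x = 0)
    (hmean : ∫ x in Ω, f x = C * (volume Ω).toReal) :
    (C ^ 2 + 1) * (volume Ω).toReal ≤ ACF Ω f v := by
  obtain ⟨hi, hval⟩ := integrable_indicator_ne_zero hv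
  have hset : volume {x ∈ Ω | v x ≠ 0} = (volume.restrict Ω) {x | v x ≠ 0} := by
    rw [Measure.restrict_apply' hΩ.measurableSet]
    congr 1
    ext x
    exact and_comm
  have hf1 : IntegrableOn f Ω := hf.integrable one_le_two
  have hC2 : 1 ≤ C ^ 2 := (one_le_sq_iff_one_le_abs C).2 hC
  have hconst : Integrable (fun _ : RH n => 1 - C ^ 2) (volume.restrict Ω) := integrable_const _
  calc (C ^ 2 + 1) * (volume Ω).toReal
      = ∫ x in Ω, (2 * C * f x + (1 - C ^ 2)) := by
        rw [integral_add (hf1.const_mul _) hconst, integral_const_mul, hmean]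
        simp only [integral_const, smul_eq_mul, Measure.real, Measure.restrict_apply_univ]
        ring
    _ ≤ ∫ x in Ω, (f x ^ 2 + {x | v x ≠ 0}.indicator (fun _ => (1 : ℝ)) x) := by
        refine integral_mono_ae ((hf1.const_mul _).add hconst) (hf.integrable_sq.add hi) ?_
        filter_upwards [(ae_restrict_iff' hΩ.measurableSet).2 hfv] with x hx
        by_cases hvx : v x = 0
        · simp [hvx, hx hvx]
          nlinarith
        · rw [indicator_of_mem (show x ∈ {x | v x ≠ 0} from hvx)]
          nlinarith [sq_nonneg (f x - C)]
    _ = ACF Ω f v := by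
        rw [integral_add hf.integrable_sq hi, hval, ACF, hset]

lemma ACF_const_le {Ω : Set (RH n)} (hΩ : volume Ω ≠ ∞) (C : ℝ) (u : RH n → ℝ) :
    ACF Ω (fun _ => C) u ≤ (C ^ 2 + 1) * (volume Ω).toReal := by
  have h : (volume {x ∈ Ω | u x ≠ 0}).toReal ≤ (volume Ω).toReal :=
    ENNReal.toReal_mono hΩ (measure_mono (sep_subset _ _))
  simp only [ACF, integral_const, smul_eq_mul, Measure.real, Measure.restrict_apply_univ]
  linarith

/-- every `w ∈ H²_loc(ℝⁿ)` with constant weak Laplacian `Δw ≡ C`,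
`|C| ≥ 1`, is a global minimizer of `F`. -/
theorem statement9 (n : ℕ) (hn : 0 < n) (w : RH n → ℝ) (C : ℝ) (hC : 1 ≤ |C|)
    (hw : MemH2loc w)
    (hlap : ∀ Ω : Set (RH n), IsOpen Ω → Bornology.IsBounded Ω →
      IsWeakLaplacian Ω w (fun _ => C)) :
    IsGlobalMinimizer w := by
  refine ⟨hw, fun Ω hΩ hb v hv hvw lapw lapv hlw hlv => ?_⟩
  rcases Ω.eq_empty_or_nonempty with rfl | hne
  · simp [ACF]
  have hpos : 0 < volume Ω := hΩ.measure_pos volume hne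
  have hfin : volume Ω ≠ ∞ := hb.measure_lt_top.ne
  have : IsFiniteMeasure (volume.restrict Ω) := isFiniteMeasure_restrict.2 hfin
  have hposR : 0 < (volume Ω).toReal := ENNReal.toReal_pos hpos.ne' hfin
  have hC0 : C ≠ 0 := fun h => by norm_num [h] at hC
  obtain ⟨gv, hv2, Hv⟩ := hv
  obtain ⟨gw, hw2, Hw⟩ := hw Ω hΩ hb
  obtain ⟨f, hfint, hflap, hf0⟩ := hvw.exists_laplacian
  have hvint : IntegrableOn v Ω := Hv.1.integrable one_le_two
  have hwint : IntegrableOn w Ω := Hw.1.integrable one_le_two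
  have hLp := Hv.memLp_laplacian
  have hLv := Hv.isWeakLaplacian
  have hzero := Hv.laplacian_ae_eq_zero hΩ
  set L : RH n → ℝ := fun x => ∑ i, hv2 i i x
  have hLint : IntegrableOn L Ω := hLp.integrable one_le_two
  have hconst : IntegrableOn (fun _ : RH n => C) Ω := integrable_const (μ := volume.restrict Ω) C
  have hsub : IsWeakLaplacian Ω (fun x => v x - w x) (fun x => L x - C) := by
    intro φ hφ
    have hΔ : ∀ {u : RH n → ℝ}, IntegrableOn u Ω →
        IntegrableOn (fun x => u x * cLaplacian φ x) Ω := fun hu => by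
      simp only [cLaplacian, Finset.mul_sum]
      exact integrable_finsetSum _ fun i _ => ((hφ.cpderiv i).cpderiv i).integrable_mul hu
    simp only [sub_mul]
    rw [integral_sub (hΔ hvint) (hΔ hwint), hLv φ hφ, hlap Ω hΩ hb φ hφ,
      ← integral_sub (hφ.integrable_mul hLint) (hφ.integrable_mul hconst)]
  have hmean : ∫ x in Ω, L x = C * (volume Ω).toReal := by
    have h := hflap.ae_eq hΩ hsub (fun φ hφ => hφ.integrable_mul hfint) (hLint.sub hconst)
    rw [setIntegral_congr_ae hΩ.measurableSet h, integral_sub hLint hconst] at hf0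
    simp only [integral_const, smul_eq_mul, Measure.real, Measure.restrict_apply_univ] at hf0
    linarith
  have hlapw : ∀ᵐ x, x ∈ Ω → lapw x = C := by
    refine (hlw.ae_eq_or_ae_eq_zero hΩ (hlap Ω hΩ hb) hconst).resolve_right fun h => hpos.ne' ?_
    simpa [hC0] using ae_iff.1 h
  have hlapv : ∀ᵐ x, x ∈ Ω → lapv x = L x := by
    refine (hlv.ae_eq_or_ae_eq_zero hΩ hLv hLint).resolve_right fun h => ?_
    rw [setIntegral_congr_ae hΩ.measurableSet h, integral_zero] at hmean
    exact mul_ne_zero hC0 hposR.ne' hmean.symm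
  rw [ACF_congr_laplacian hΩ hlapw, ACF_congr_laplacian hΩ hlapv]
  exact (ACF_const_le hfin C w).trans
    (le_ACF_of_integral_eq hΩ hC Hv.1.1.aemeasurable hLp hzero hmean)

end
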